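/- arXiv:hep-th/9602016 — 7 statements merged into one kernel-verified Lean document; each statement's English description precedes it below -/
import Mathlib

section
/- Let R be a commutative ring and let D₁,…,Dₙ : R → R (n ≥ 2) be pairwise commuting derivations of R (Dᵢ∘Dⱼ = Dⱼ∘Dᵢ for all i,j). Define the bracket [f₁,…,fₙ] := Σ_{σ∈Sₙ} sgn(σ) · D_{σ(1)}(f₁)·D_{σ(2)}(f₂)⋯D_{σ(n)}(fₙ). Then this bracket satisfies the Fundamental Identity: for all f₁,…,f_{2n-1} ∈ R, [f₁,…,f_{n-1},[fₙ,…,f_{2n-1}]] = [[f₁,…,f_{n-1},fₙ],f_{n+1},…,f_{2n-1}] + [fₙ,[f₁,…,f_{n-1},f_{n+1}],f_{n+2},…,f_{2n-1}] + ⋯ + [fₙ,f_{n+1},…,f_{2n-2},[f₁,…,f_{n-1},f_{2n-1}]]. -/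
/-- The Nambu bracket of order `n` associated to a family of maps
`D : Fin n → R → R`, given by the "modified Jacobian"
`[f₁,…,fₙ] = Σ_{σ ∈ Sₙ} sgn σ • D_{σ(1)}(f₁) ⋯ D_{σ(n)}(fₙ)`. -/
noncomputable def nambuBracket {R : Type*} [CommRing R] {n : ℕ}
    (D : Fin n → R → R) (f : Fin n → R) : R :=
  ∑ σ : Equiv.Perm (Fin n), (Equiv.Perm.sign σ : ℤ) • ∏ i, D (σ i) (f i)

/-- The Leibniz rule for a product over a finite type. -/
theorem Derivation.map_prod_univ {R ι : Type*} [CommRing R] [DecidableEq ι] [Fintype ι]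
    (d : Derivation ℤ R R) (a : ι → R) :
    d (∏ i, a i) = ∑ k, ∏ i, Function.update a k (d (a k)) i := by
  have key : ∀ s : Finset ι, d (∏ i ∈ s, a i) =
      ∑ k ∈ s, ∏ i ∈ s, Function.update a k (d (a k)) i := by
    intro s
    induction s using Finset.induction_on with
    | empty => simp
    | insert j s hj ih =>
      rw [Finset.prod_insert hj, Derivation.leibniz, ih, Finset.sum_insert hj,
        Finset.prod_insert hj, Function.update_self, Finset.prod_update_of_notMem hj,
        smul_eq_mul, smul_eq_mul, Finset.mul_sum, add_comm, mul_comm]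
      congr 1
      refine Finset.sum_congr rfl fun k hk => ?_
      rw [Finset.prod_insert hj, Function.update_of_ne (ne_of_mem_of_not_mem hk hj).symm]
  exact key Finset.univ

/-- A derivation acts on a determinant column by column. -/
theorem Derivation.map_det {R ι : Type*} [CommRing R] [DecidableEq ι] [Fintype ι]
    (d : Derivation ℤ R R) (M : Matrix ι ι R) :
    d M.det = ∑ k, (M.updateCol k fun i => d (M i k)).det := by
  simp only [Matrix.det_apply, Units.smul_def, map_sum, map_zsmul, d.map_prod_univ,
    Finset.smul_sum]
  rw [Finset.sum_comm]
  refine Finset.sum_congr rfl fun k _ => Finset.sum_congr rfl fun σ _ => ?_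
  congr 1
  refine Finset.prod_congr rfl fun i _ => ?_
  by_cases h : i = k
  · subst h; simp
  · simp [h]

/-- Replacing, one at a time, the columns of `M` by those of `A * M` multiplies the determinant
by the trace of `A`. -/
theorem Matrix.sum_det_updateCol_mul {R ι : Type*} [CommRing R] [DecidableEq ι] [Fintype ι]
    (A M : Matrix ι ι R) :
    ∑ k, (M.updateCol k fun i => (A * M) i k).det = A.trace * M.det := by
  have h : ∀ k, (M.updateCol k fun i => (A * M) i k).det = (M.adjugate * (A * M)) k k := by
    intro k
    rw [← Matrix.cramer_apply, Matrix.cramer_eq_adjugate_mulVec]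
    rfl
  calc ∑ k, (M.updateCol k fun i => (A * M) i k).det
      = (M.adjugate * (A * M)).trace := Finset.sum_congr rfl fun k _ => h k
    _ = A.trace * M.det := by
      rw [Matrix.trace_mul_comm, Matrix.mul_assoc, Matrix.mul_adjugate, Matrix.mul_smul,
        Matrix.mul_one, Matrix.trace_smul, smul_eq_mul, mul_comm]

theorem nambuBracket_eq_det {R : Type*} [CommRing R] {n : ℕ} (D : Fin n → R → R)
    (f : Fin n → R) :
    nambuBracket D f = (Matrix.of fun i k => D i (f k)).det := by
  simp [nambuBracket, Matrix.det_apply, Units.smul_def]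

/-- The coefficient of `D j` in the vector field `h ↦ [f₁,…,fₘ,h]`. -/
def nambuCoeff {R : Type*} [CommRing R] {m : ℕ} (D : Fin (m + 1) → R → R)
    (f : Fin m → R) (j : Fin (m + 1)) : R :=
  ∑ σ : Equiv.Perm (Fin (m + 1)) with σ (Fin.last m) = j,
    (Equiv.Perm.sign σ : ℤ) • ∏ i : Fin m, D (σ i.castSucc) (f i)

theorem nambuBracket_snoc {R : Type*} [CommRing R] {m : ℕ} (D : Fin (m + 1) → R → R)
    (f : Fin m → R) (h : R) :
    nambuBracket D (Fin.snoc f h) = ∑ j, nambuCoeff D f j * D j h := by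
  simp only [nambuBracket, nambuCoeff, Finset.sum_mul]
  rw [← Finset.sum_fiberwise _ fun σ : Equiv.Perm (Fin (m + 1)) => σ (Fin.last m)]
  refine Finset.sum_congr rfl fun j _ => Finset.sum_congr rfl fun σ hσ => ?_
  rw [Fin.prod_univ_castSucc, ← (Finset.mem_filter.1 hσ).2]
  simp [mul_assoc]

/-- For commuting derivations, the vector field `h ↦ [f₁,…,fₘ,h]` is divergence free. -/
theorem sum_apply_nambuCoeff {R : Type*} [CommRing R] {m : ℕ}
    (d : Fin (m + 1) → Derivation ℤ R R) (hcomm : ∀ i j a, d i (d j a) = d j (d i a))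
    (f : Fin m → R) :
    ∑ j, d j (nambuCoeff (fun i => d i) f j) = 0 := by
  have h : ∑ j, d j (nambuCoeff (fun i => d i) f j) =
      ∑ σ : Equiv.Perm (Fin (m + 1)), (Equiv.Perm.sign σ : ℤ) •
        d (σ (Fin.last m)) (∏ i : Fin m, d (σ i.castSucc) (f i)) := by
    rw [← Finset.sum_fiberwise _ fun σ : Equiv.Perm (Fin (m + 1)) => σ (Fin.last m)]
    refine Finset.sum_congr rfl fun j _ => ?_
    rw [nambuCoeff, map_sum]
    refine Finset.sum_congr rfl fun σ hσ => ?_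
    rw [map_zsmul, (Finset.mem_filter.1 hσ).2]
  simp only [h, Derivation.map_prod_univ, Finset.smul_sum]
  rw [Finset.sum_comm]
  refine Finset.sum_eq_zero fun k _ => ?_
  have hk : k.castSucc ≠ Fin.last m := (Fin.castSucc_lt_last k).ne
  refine Finset.sum_involution (fun σ _ => σ * Equiv.swap k.castSucc (Fin.last m))
    (fun σ _ => ?_) (fun σ _ _ hσ => hk ?_) (fun _ _ => Finset.mem_univ _) (fun σ _ => ?_)
  · have hprod : ∀ i : Fin m,
        Function.update (fun i : Fin m =>
            d ((σ * Equiv.swap k.castSucc (Fin.last m)) i.castSucc) (f i)) k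
          (d ((σ * Equiv.swap k.castSucc (Fin.last m)) (Fin.last m))
            (d ((σ * Equiv.swap k.castSucc (Fin.last m)) k.castSucc) (f k))) i =
        Function.update (fun i : Fin m => d (σ i.castSucc) (f i)) k
          (d (σ (Fin.last m)) (d (σ k.castSucc) (f k))) i := by
      intro i
      by_cases hi : i = k
      · subst hi
        simp [hcomm]
      · have hik : i.castSucc ≠ k.castSucc := fun e => hi (Fin.castSucc_injective m e)
        have hil : i.castSucc ≠ Fin.last m := (Fin.castSucc_lt_last i).ne
        simp [hi, Equiv.swap_apply_of_ne_of_ne hik hil]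
    simp only [hprod, Equiv.Perm.sign_mul, Equiv.Perm.sign_swap hk]
    simp
  · simp at hσ
  · simp [mul_assoc]

/-- If `D₁,…,Dₙ` (`n = m+1 ≥ 2`) are pairwise commuting
derivations of a commutative ring `R`, then the bracket
`[f₁,…,fₙ] = Σ_σ sgn σ • D_{σ(1)}(f₁)⋯D_{σ(n)}(fₙ)` satisfies the
Fundamental Identity. -/
theorem nambuBracket_fundamental_identity {R : Type*} [CommRing R] {m : ℕ}
    (hm : 1 ≤ m) (D : Fin (m + 1) → R → R)
    (hadd : ∀ i a b, D i (a + b) = D i a + D i b)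
    (hleibniz : ∀ i a b, D i (a * b) = D i a * b + a * D i b)
    (hcomm : ∀ i j a, D i (D j a) = D j (D i a))
    (f : Fin m → R) (g : Fin (m + 1) → R) :
    nambuBracket D (Fin.snoc f (nambuBracket D g)) =
      ∑ k : Fin (m + 1),
        nambuBracket D
          (Function.update g k (nambuBracket D (Fin.snoc f (g k)))) := by
  obtain ⟨d, rfl⟩ : ∃ d : Fin (m + 1) → Derivation ℤ R R, D = fun i => ⇑(d i) :=
    ⟨fun i => Derivation.mk' (AddMonoidHom.mk' (D i) (hadd i)).toIntLinearMap fun a b => by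
      simp [hleibniz, mul_comm, add_comm], rfl⟩
  beta_reduce at hcomm
  let c := nambuCoeff (fun i => ⇑(d i)) f
  let X : Derivation ℤ R R := ∑ j, c j • d j
  have hX_apply : ∀ h, X h = ∑ j, c j * d j h := by
    intro h
    exact (congrFun (map_sum Derivation.coeFnAddMonoidHom (fun j => c j • d j) Finset.univ) h).trans
      (Finset.sum_apply _ _ _)
  have hX : ∀ h, nambuBracket (fun i => ⇑(d i)) (Fin.snoc f h) = X h := by
    intro h
    rw [nambuBracket_snoc, hX_apply]
  let J : Matrix (Fin (m + 1)) (Fin (m + 1)) R := Matrix.of fun i k => d i (g k)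
  let A : Matrix (Fin (m + 1)) (Fin (m + 1)) R := Matrix.of fun i j => d i (c j)
  have hA : A.trace = 0 := sum_apply_nambuCoeff d hcomm f
  have hdX : ∀ i h, d i (X h) = X (d i h) + ∑ j, d i (c j) * d j h := by
    intro i h
    rw [hX_apply, hX_apply, map_sum, ← Finset.sum_add_distrib]
    refine Finset.sum_congr rfl fun j _ => ?_
    rw [Derivation.leibniz, hcomm i j, smul_eq_mul, smul_eq_mul, mul_comm (d j h)]
  have hcol : ∀ k, nambuBracket (fun i => ⇑(d i)) (Function.update g k (X (g k))) =
      (J.updateCol k fun i => X (J i k)).det + (J.updateCol k fun i => (A * J) i k).det := by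
    intro k
    rw [nambuBracket_eq_det, ← Matrix.det_updateCol_add]
    congr 1
    ext i l
    by_cases hl : l = k
    · subst hl
      simp [hdX, Matrix.mul_apply, A, J]
    · simp [hl, J]
  simp only [hX, hcol]
  rw [Finset.sum_add_distrib, Matrix.sum_det_updateCol_mul, hA, zero_mul, add_zero,
    nambuBracket_eq_det, ← Derivation.map_det]
end

section
/- For n ≥ 2 and smooth functions f₁,…,f_{2n-1} : ℝⁿ → ℝ (ContDiff of order ∞), define the canonical Nambu bracket as the Jacobian {g₁,…,gₙ}(x) := Σ_{σ∈Sₙ} sgn(σ) · ∂g₁/∂x_{σ(1)}(x) ⋯ ∂gₙ/∂x_{σ(n)}(x). Then the Fundamental Identity holds: {f₁,…,f_{n-1},{fₙ,…,f_{2n-1}}} = {{f₁,…,f_{n-1},fₙ},f_{n+1},…,f_{2n-1}} + {fₙ,{f₁,…,f_{n-1},f_{n+1}},f_{n+2},…,f_{2n-1}} + ⋯ + {fₙ,…,f_{2n-2},{f₁,…,f_{n-1},f_{2n-1}}} as smooth functions on ℝⁿ. -/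
/-- The `i`-th partial derivative of a function `g : ℝⁿ → ℝ`. -/
noncomputable def partialDeriv {n : ℕ} (i : Fin n) (g : (Fin n → ℝ) → ℝ) :
    (Fin n → ℝ) → ℝ :=
  fun x => fderiv ℝ g x (Pi.single i 1)

/-- The canonical Nambu bracket (Jacobian) of `n` functions on `ℝⁿ`:
`{g₁,…,gₙ}(x) = Σ_{σ∈Sₙ} sgn σ • ∂g₁/∂x_{σ(1)}(x) ⋯ ∂gₙ/∂x_{σ(n)}(x)`. -/
noncomputable def nambuJacobian {n : ℕ} (g : Fin n → ((Fin n → ℝ) → ℝ)) :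
    (Fin n → ℝ) → ℝ :=
  fun x =>
    ∑ σ : Equiv.Perm (Fin n),
      (Equiv.Perm.sign σ : ℤ) • ∏ i, partialDeriv (σ i) (g i) x

open Matrix

section MatrixLemmas

variable {ι R : Type*} [Fintype ι] [DecidableEq ι] [CommRing R]

theorem Matrix.det_updateRow_eq_sum_adjugate_mul (A : Matrix ι ι R) (k : ι) (v : ι → R) :
    (A.updateRow k v).det = ∑ j, A.adjugate j k * v j := by
  rw [← cramer_transpose_apply, cramer_eq_adjugate_mulVec, ← adjugate_transpose]
  rfl

theorem Matrix.det_updateRow_updateRow_swap (A : Matrix ι ι R) {k l : ι} (hkl : k ≠ l)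
    (u v : ι → R) :
    ((A.updateRow l u).updateRow k v).det = -((A.updateRow l v).updateRow k u).det := by
  have h := det_permute (Equiv.swap k l) ((A.updateRow l v).updateRow k u)
  rw [Equiv.Perm.sign_swap hkl, Units.val_neg, Units.val_one, Int.cast_neg, Int.cast_one,
    neg_one_mul] at h
  rw [← h]
  congr 1
  ext i j
  by_cases hk : i = k
  · subst hk; simp [updateRow_apply, hkl.symm]
  · by_cases hl : i = l
    · subst hl; simp [updateRow_apply, hkl.symm]
    · simp [updateRow_apply, hk, hl, Equiv.swap_apply_of_ne_of_ne hk hl]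

end MatrixLemmas

theorem HasFDerivAt.matrix_det {ι E : Type*} [Fintype ι] [DecidableEq ι]
    [NormedAddCommGroup E] [NormedSpace ℝ E] {M : E → Matrix ι ι ℝ}
    {M' : Matrix ι ι (E →L[ℝ] ℝ)} {x : E}
    (hM : ∀ i j, HasFDerivAt (fun y => M y i j) (M' i j) x) :
    HasFDerivAt (fun y => (M y).det) (∑ k, ∑ j, (M x).adjugate j k • M' k j) x := by
  have h : HasFDerivAt (fun y => (M y).det)
      (∑ σ : Equiv.Perm ι, ((Equiv.Perm.sign σ : ℤ) : ℝ) •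
        ∑ k, (∏ j ∈ Finset.univ.erase k, M x j (σ j)) • M' k (σ k)) x := by
    have : (fun y => (M y).det) = fun y => ∑ σ : Equiv.Perm ι, ((Equiv.Perm.sign σ : ℤ) : ℝ) *
        ∏ i, M y i (σ i) := by
      funext y
      rw [← det_transpose, det_apply']
      rfl
    rw [this]
    exact HasFDerivAt.fun_sum fun σ _ =>
      (HasFDerivAt.finsetProd fun i _ => hM i (σ i)).const_mul _
  convert h using 1
  ext v
  simp only [_root_.sum_apply, _root_.smul_apply, smul_eq_mul,
    Finset.mul_sum]
  rw [Finset.sum_comm (s := (Finset.univ : Finset (Equiv.Perm ι)))]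
  refine Finset.sum_congr rfl fun k _ => ?_
  rw [← Matrix.det_updateRow_eq_sum_adjugate_mul (M x) k (fun j => M' k j v), ← det_transpose,
    det_apply']
  refine Finset.sum_congr rfl fun σ _ => ?_
  rw [← Finset.mul_prod_erase _ _ (Finset.mem_univ k)]
  have : ∏ j ∈ Finset.univ.erase k, ((M x).updateRow k fun j => M' k j v)ᵀ (σ j) j
      = ∏ j ∈ Finset.univ.erase k, M x j (σ j) :=
    Finset.prod_congr rfl fun j hj => by
      simp [updateRow_ne (Finset.ne_of_mem_erase hj)]
  rw [this]
  simp
  ring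

section PartialDeriv

variable {n : ℕ}

theorem ContDiff.hasFDerivAt_partialDeriv {g : (Fin n → ℝ) → ℝ} (hg : ContDiff ℝ (⊤ : ℕ∞) g)
    (i : Fin n) (x : Fin n → ℝ) :
    HasFDerivAt (partialDeriv i g) (fderiv ℝ (partialDeriv i g) x) x := by
  have h : Differentiable ℝ (fderiv ℝ g) :=
    (hg.fderiv_right (m := 1) (WithTop.coe_le_coe.mpr le_top)).differentiable one_ne_zero
  exact (h.clm_apply (differentiable_const _) x).hasFDerivAt

theorem ContDiff.partialDeriv_comm {g : (Fin n → ℝ) → ℝ} (hg : ContDiff ℝ (⊤ : ℕ∞) g)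
    (i j : Fin n) (x : Fin n → ℝ) :
    partialDeriv i (partialDeriv j g) x = partialDeriv j (partialDeriv i g) x := by
  have h : DifferentiableAt ℝ (fderiv ℝ g) x :=
    (hg.fderiv_right (m := 1) (WithTop.coe_le_coe.mpr le_top)).differentiable one_ne_zero x
  have key (a b : Fin n) : partialDeriv a (partialDeriv b g) x =
      fderiv ℝ (fderiv ℝ g) x (Pi.single a 1) (Pi.single b 1) := by
    change fderiv ℝ (fun y => fderiv ℝ g y (Pi.single b 1)) x (Pi.single a 1) = _
    rw [fderiv_clm_apply h (differentiableAt_const _)]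
    simp
  rw [key, key]
  exact (hg.contDiffAt.isSymmSndFDerivAt
    (by
      rw [minSmoothness_of_isRCLikeNormedField]
      exact WithTop.coe_le_coe.mpr le_top)).eq _ _

/-- The Jacobian matrix, whose rows are the gradients of the component functions. -/
noncomputable def jacobianMatrix (g : Fin n → ((Fin n → ℝ) → ℝ)) (x : Fin n → ℝ) :
    Matrix (Fin n) (Fin n) ℝ :=
  Matrix.of fun i j => partialDeriv j (g i) x

theorem nambuJacobian_eq_det (g : Fin n → ((Fin n → ℝ) → ℝ)) (x : Fin n → ℝ) :
    nambuJacobian g x = (jacobianMatrix g x).det := by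
  rw [← det_transpose, det_apply]
  rfl

theorem nambuJacobian_update (g : Fin n → ((Fin n → ℝ) → ℝ)) (k : Fin n) (h : (Fin n → ℝ) → ℝ)
    (x : Fin n → ℝ) :
    nambuJacobian (Function.update g k h) x =
      ∑ j, (jacobianMatrix g x).adjugate j k * partialDeriv j h x := by
  rw [nambuJacobian_eq_det, ← det_updateRow_eq_sum_adjugate_mul]
  congr 1
  ext i j
  by_cases hi : i = k
  · subst hi; simp [jacobianMatrix]
  · simp [jacobianMatrix, hi]

theorem partialDeriv_nambuJacobian {g : Fin n → ((Fin n → ℝ) → ℝ)}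
    (hg : ∀ i, ContDiff ℝ (⊤ : ℕ∞) (g i)) (i : Fin n) (x : Fin n → ℝ) :
    partialDeriv i (nambuJacobian g) x =
      ∑ k, ∑ j, (jacobianMatrix g x).adjugate j k * partialDeriv i (partialDeriv j (g k)) x := by
  have h := HasFDerivAt.matrix_det (M := jacobianMatrix g) (x := x)
    (M' := Matrix.of fun k j => fderiv ℝ (partialDeriv j (g k)) x)
    fun k j => (hg k).hasFDerivAt_partialDeriv j x
  rw [partialDeriv, funext (nambuJacobian_eq_det g), h.fderiv]
  simp [partialDeriv]

theorem hasFDerivAt_adjugate_jacobianMatrix {g : Fin n → ((Fin n → ℝ) → ℝ)}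
    (hg : ∀ i, ContDiff ℝ (⊤ : ℕ∞) (g i)) (j l : Fin n) (x : Fin n → ℝ) :
    HasFDerivAt (fun y => (jacobianMatrix g y).adjugate j l)
      (∑ k, ∑ i, ((jacobianMatrix g x).updateRow l (Pi.single j 1)).adjugate i k •
        if k = l then 0 else fderiv ℝ (partialDeriv i (g k)) x) x := by
  simp only [adjugate_apply (jacobianMatrix g _) j l]
  refine HasFDerivAt.matrix_det
    (M' := Matrix.of fun k i => if k = l then 0 else fderiv ℝ (partialDeriv i (g k)) x)
    fun k i => ?_
  by_cases hk : k = l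
  · subst hk
    simpa using hasFDerivAt_const _ _
  · simp only [updateRow_ne hk, of_apply, if_neg hk]
    exact (hg k).hasFDerivAt_partialDeriv i x

/-- The Piola identity: the cofactor matrix of a Jacobian matrix is divergence free. -/
theorem sum_partialDeriv_adjugate_jacobianMatrix {g : Fin n → ((Fin n → ℝ) → ℝ)}
    (hg : ∀ i, ContDiff ℝ (⊤ : ℕ∞) (g i)) (l : Fin n) (x : Fin n → ℝ) :
    ∑ j, partialDeriv j (fun y => (jacobianMatrix g y).adjugate j l) x = 0 := by
  have h (j : Fin n) : partialDeriv j (fun y => (jacobianMatrix g y).adjugate j l) x =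
      ∑ k, ∑ i, ((jacobianMatrix g x).updateRow l (Pi.single j 1)).adjugate i k *
        if k = l then 0 else partialDeriv j (partialDeriv i (g k)) x := by
    rw [partialDeriv, (hasFDerivAt_adjugate_jacobianMatrix hg j l x).fderiv]
    simp only [_root_.sum_apply, _root_.smul_apply, smul_eq_mul]
    refine Finset.sum_congr rfl fun k _ => Finset.sum_congr rfl fun i _ => ?_
    split_ifs <;> simp [partialDeriv]
  simp only [h]
  rw [Finset.sum_comm]
  refine Finset.sum_eq_zero fun k _ => ?_
  by_cases hk : k = l
  · simp [hk]
  refine self_eq_neg.mp ?_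
  conv_lhs => rw [Finset.sum_comm]
  simp only [← Finset.sum_neg_distrib]
  refine Finset.sum_congr rfl fun i _ => Finset.sum_congr rfl fun j _ => ?_
  rw [adjugate_apply, adjugate_apply, det_updateRow_updateRow_swap _ hk, if_neg hk,
    (hg k).partialDeriv_comm, if_neg hk, neg_mul]

theorem partialDeriv_nambuJacobian_update {g : Fin n → ((Fin n → ℝ) → ℝ)}
    (hg : ∀ i, ContDiff ℝ (⊤ : ℕ∞) (g i)) (l : Fin n) {h : (Fin n → ℝ) → ℝ}
    (hh : ContDiff ℝ (⊤ : ℕ∞) h) (i : Fin n) (x : Fin n → ℝ) :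
    partialDeriv i (nambuJacobian (Function.update g l h)) x =
      ∑ j, ((jacobianMatrix g x).adjugate j l * partialDeriv j (partialDeriv i h) x +
        partialDeriv i (fun y => (jacobianMatrix g y).adjugate j l) x * partialDeriv j h x) := by
  have key := HasFDerivAt.fun_sum (u := Finset.univ) fun j _ =>
    (hasFDerivAt_adjugate_jacobianMatrix hg j l x).differentiableAt.hasFDerivAt.fun_mul
      (hh.hasFDerivAt_partialDeriv j x)
  rw [partialDeriv, funext (nambuJacobian_update g l h), key.fderiv]
  simp only [_root_.sum_apply, _root_.add_apply,
    _root_.smul_apply, smul_eq_mul]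
  refine Finset.sum_congr rfl fun j _ => ?_
  rw [hh.partialDeriv_comm j i x, mul_comm (partialDeriv i _ x)]
  rfl

theorem nambuJacobian_update_nambuJacobian {f g : Fin n → ((Fin n → ℝ) → ℝ)}
    (hf : ∀ i, ContDiff ℝ (⊤ : ℕ∞) (f i)) (hg : ∀ i, ContDiff ℝ (⊤ : ℕ∞) (g i)) (l : Fin n) :
    nambuJacobian (Function.update f l (nambuJacobian g)) =
      ∑ k, nambuJacobian
        (Function.update g k (nambuJacobian (Function.update f l (g k)))) := by
  funext x
  have hdiv : ∑ k, ∑ i, ∑ j, (jacobianMatrix g x).adjugate i k *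
      (partialDeriv i (fun y => (jacobianMatrix f y).adjugate j l) x *
        partialDeriv j (g k) x) = 0 := by
    have hadj (i j : Fin n) : ∑ k, (jacobianMatrix g x).adjugate i k * partialDeriv j (g k) x =
        if i = j then (jacobianMatrix g x).det else 0 := by
      have := congrFun (congrFun (adjugate_mul (jacobianMatrix g x)) i) j
      simpa [mul_apply, jacobianMatrix, one_apply] using this
    calc
      _ = ∑ i, ∑ j, partialDeriv i (fun y => (jacobianMatrix f y).adjugate j l) x *
          ∑ k, (jacobianMatrix g x).adjugate i k * partialDeriv j (g k) x := by
        rw [Finset.sum_comm]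
        refine Finset.sum_congr rfl fun i _ => ?_
        rw [Finset.sum_comm]
        refine Finset.sum_congr rfl fun j _ => ?_
        rw [Finset.mul_sum]
        exact Finset.sum_congr rfl fun k _ => by ring
      _ = 0 := by
        simp [hadj, ← Finset.sum_mul, sum_partialDeriv_adjugate_jacobianMatrix hf l x]
  simp only [Finset.sum_apply, nambuJacobian_update, partialDeriv_nambuJacobian hg,
    partialDeriv_nambuJacobian_update hf l (hg _), Finset.mul_sum, mul_add,
    Finset.sum_add_distrib, hdiv, add_zero]
  rw [Finset.sum_comm]
  refine Finset.sum_congr rfl fun k _ => ?_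
  rw [Finset.sum_comm]
  exact Finset.sum_congr rfl fun i _ => Finset.sum_congr rfl fun j _ => by ring

end PartialDeriv

/-- For `n = m+1 ≥ 2` and smooth functions
`f₁,…,f_{n-1}, g₁,…,gₙ : ℝⁿ → ℝ`, the canonical Nambu bracket (the
Jacobian) satisfies the Fundamental Identity. -/
theorem nambuJacobian_fundamental_identity {m : ℕ} (hm : 1 ≤ m)
    (f : Fin m → ((Fin (m + 1) → ℝ) → ℝ))
    (g : Fin (m + 1) → ((Fin (m + 1) → ℝ) → ℝ))
    (hf : ∀ i, ContDiff ℝ (⊤ : ℕ∞) (f i)) (hg : ∀ i, ContDiff ℝ (⊤ : ℕ∞) (g i)) :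
    nambuJacobian (Fin.snoc f (nambuJacobian g)) =
      ∑ k : Fin (m + 1),
        nambuJacobian
          (Function.update g k (nambuJacobian (Fin.snoc f (g k)))) := by
  have hF : ∀ i, ContDiff ℝ (⊤ : ℕ∞) (Fin.snoc (α := fun _ => (Fin (m + 1) → ℝ) → ℝ) f 0 i) := by
    intro i
    refine Fin.lastCases ?_ (fun i => ?_) i
    · rw [Fin.snoc_last]
      exact contDiff_const
    · simpa using hf i
  have hsnoc (h : (Fin (m + 1) → ℝ) → ℝ) :
      (Fin.snoc f h : Fin (m + 1) → ((Fin (m + 1) → ℝ) → ℝ)) =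
        Function.update (Fin.snoc f 0) (Fin.last m) h := by
    rw [Fin.update_snoc_last]
  rw [hsnoc, nambuJacobian_update_nambuJacobian hF hg (Fin.last m)]
  exact Finset.sum_congr rfl fun k _ => by rw [hsnoc (g k)]
end

section
/- (Theorem 3, part iv.) In the setting of the β-product: assume T∘β = id_A (equivalently, 1 is a unit element for ×_β on A), assume the β-product is a deformation of the usual product, i.e. π(f ×_β g) = f·g for all f, g ∈ A, and assume ×_β is associative. Then the β-product coincides with the usual product: f ×_β g = f·g for all f, g ∈ A. -/
/-- The `β`-product on `A[ℏ]`: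
`F ×_β G := T(β(π F) ⊗ β(π G))`, where `π` takes the coefficient of `ℏ⁰`
(so that the extension of `β` to `A[ℏ]` annihilates the non-zero powers
of `ℏ`), and `⊗` is the product of the (symmetric) algebra `S`. -/
noncomputable def betaProd {A S : Type*} [CommRing A] [Algebra ℝ A]
    [CommRing S] [Algebra ℝ S] (T : S →ₗ[ℝ] Polynomial A) (β : A → S)
    (F G : Polynomial A) : Polynomial A :=
  T (β (F.coeff 0) * β (G.coeff 0))

/-- (Theorem 3, part iv, of the paper.)  If `T ∘ β = id_A`
(equivalently `1` is a unit for the `β`-product on `A`), the `β`-product is a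
deformation of the usual product, and it is associative, then it coincides
with the usual product of `A`. -/
theorem betaProd_eq_usual_of_assoc (A : Type*) [CommRing A] [Algebra ℝ A]
    (S : Type*) [CommRing S] [Algebra ℝ S] (ι : A →ₗ[ℝ] S)
    (hgen : Algebra.adjoin ℝ (Set.range ι) = ⊤)
    (star : Polynomial A → Polynomial A → Polynomial A)
    (star_assoc : ∀ F G H, star (star F G) H = star F (star G H))
    (star_add_left : ∀ F F' G, star (F + F') G = star F G + star F' G)
    (star_add_right : ∀ F G G', star F (G + G') = star F G + star F G')
    (star_smul_left : ∀ (c : ℝ) F G, star (c • F) G = c • star F G)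
    (star_smul_right : ∀ (c : ℝ) F G, star F (c • G) = c • star F G)
    (star_X_left : ∀ F G, star (Polynomial.X * F) G = Polynomial.X * star F G)
    (star_X_right : ∀ F G, star F (Polynomial.X * G) = Polynomial.X * star F G)
    (star_classical : ∀ f g : A,
        (star (Polynomial.C f) (Polynomial.C g)).coeff 0 = f * g)
    (T : S →ₗ[ℝ] Polynomial A) (hT_one : T 1 = 1)
    (hT_symm : ∀ (n : ℕ) (f : Fin (n + 1) → A),
        T (∏ i, ι (f i)) =
          ((n + 1).factorial : ℝ)⁻¹ •
            ∑ σ : Equiv.Perm (Fin (n + 1)),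
              (List.ofFn fun i : Fin n =>
                  Polynomial.C (f (σ i.succ))).foldl star
                (Polynomial.C (f (σ 0))))
    (β : A → S) (hβ_one : β 1 = 1)
    -- T ∘ β = id_A
    (hTβ : ∀ f : A, T (β f) = Polynomial.C f)
    -- the β-product is a deformation of the usual product
    (hdef : ∀ f g : A,
        (betaProd T β (Polynomial.C f) (Polynomial.C g)).coeff 0 = f * g)
    -- the β-product is associative
    (hassoc : ∀ F G H : Polynomial A,
        betaProd T β (betaProd T β F G) H = betaProd T β F (betaProd T β G H)) :
    ∀ f g : A,
      betaProd T β (Polynomial.C f) (Polynomial.C g) = Polynomial.C (f * g) := by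
  intro f g
  have betaProd_one (F : Polynomial A) : betaProd T β F 1 = Polynomial.C (F.coeff 0) := by
    simp [betaProd, hβ_one, hTβ]
  have h := hassoc (Polynomial.C f) (Polynomial.C g) 1
  rw [betaProd_one, betaProd_one, hdef, Polynomial.coeff_C_zero] at h
  exact h.symm
end

section
/- (Theorem 3, part v.) In the setting of the β-product: assume β is multiplicative, i.e. β(f·g) = β(f) ⊗ β(g) for all f, g ∈ A, and assume the β-product is a deformation of the usual product, i.e. π(f ×_β g) = f·g for all f, g ∈ A. Then the β-product is associative: (F ×_β G) ×_β H = F ×_β (G ×_β H) for all F, G, H ∈ A[ℏ]. -/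
/-- (Theorem 3, part v, of the paper.)  If `β` is an algebra
homomorphism (multiplicative) and the `β`-product is a deformation of the
usual product, then the `β`-product is associative on `A[ℏ]`. -/
theorem betaProd_assoc_of_hom (A : Type*) [CommRing A] [Algebra ℝ A]
    (S : Type*) [CommRing S] [Algebra ℝ S] (ι : A →ₗ[ℝ] S)
    (hgen : Algebra.adjoin ℝ (Set.range ι) = ⊤)
    (star : Polynomial A → Polynomial A → Polynomial A)
    (star_assoc : ∀ F G H, star (star F G) H = star F (star G H))
    (star_add_left : ∀ F F' G, star (F + F') G = star F G + star F' G)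
    (star_add_right : ∀ F G G', star F (G + G') = star F G + star F G')
    (star_smul_left : ∀ (c : ℝ) F G, star (c • F) G = c • star F G)
    (star_smul_right : ∀ (c : ℝ) F G, star F (c • G) = c • star F G)
    (star_X_left : ∀ F G, star (Polynomial.X * F) G = Polynomial.X * star F G)
    (star_X_right : ∀ F G, star F (Polynomial.X * G) = Polynomial.X * star F G)
    (star_classical : ∀ f g : A,
        (star (Polynomial.C f) (Polynomial.C g)).coeff 0 = f * g)
    (T : S →ₗ[ℝ] Polynomial A) (hT_one : T 1 = 1)
    (hT_symm : ∀ (n : ℕ) (f : Fin (n + 1) → A),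
        T (∏ i, ι (f i)) =
          ((n + 1).factorial : ℝ)⁻¹ •
            ∑ σ : Equiv.Perm (Fin (n + 1)),
              (List.ofFn fun i : Fin n =>
                  Polynomial.C (f (σ i.succ))).foldl star
                (Polynomial.C (f (σ 0))))
    (β : A → S) (hβ_one : β 1 = 1)
    -- β is multiplicative
    (hβ_mul : ∀ f g : A, β (f * g) = β f * β g)
    -- the β-product is a deformation of the usual product
    (hdef : ∀ f g : A,
        (betaProd T β (Polynomial.C f) (Polynomial.C g)).coeff 0 = f * g) :
    ∀ F G H : Polynomial A,
      betaProd T β (betaProd T β F G) H = betaProd T β F (betaProd T β G H) := by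
  intro F G H
  have coeff_zero_betaProd (F G : Polynomial A) :
      (betaProd T β F G).coeff 0 = F.coeff 0 * G.coeff 0 := by
    simpa [betaProd] using hdef (F.coeff 0) (G.coeff 0)
  rw [betaProd, betaProd.eq_def T β F (betaProd T β G H)]
  rw [coeff_zero_betaProd, coeff_zero_betaProd, hβ_mul, hβ_mul, mul_assoc]
end

section
/- (Theorem 4.) The map ×_α defined by P ×_α Q := T(α(P) ⊗ α(Q)) maps N₁^ℏ × N₁^ℏ into N₁^ℏ; it is commutative and associative on N₁^ℏ; the classical part is multiplicative, π(P ×_α Q) = π(P)·π(Q) for all P, Q ∈ N₁^ℏ; and in particular for normalized polynomials P, Q ∈ N₁ the coefficient of ℏ⁰ in P ×_α Q equals the ordinary product P·Q, so ×_α is a deformation of the usual product on N₁. -/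
/-- `N = ℝ[x₁,x₂,x₃]`, the polynomials in three real variables. -/
abbrev NPoly : Type := MvPolynomial (Fin 3) ℝ

/-- Partial derivative with respect to the `i`-th variable. -/
noncomputable def pd (i : Fin 3) : NPoly → NPoly :=
  fun f => MvPolynomial.pderiv i f

/-- The `r`-th power of the Poisson bracket bidifferential operator in the
variables `(x₁,x₂)`:
`P^r(f,g) = Σ_{k=0}^{r} (-1)^k (r choose k) (∂₁^{r-k}∂₂^{k} f)·(∂₁^{k}∂₂^{r-k} g)`. -/
noncomputable def poissonPow (r : ℕ) (f g : NPoly) : NPoly :=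
  ∑ k ∈ Finset.range (r + 1),
    ((-1 : ℝ) ^ k * (r.choose k : ℝ)) •
      ((pd 0)^[r - k] ((pd 1)^[k] f) * (pd 0)^[k] ((pd 1)^[r - k] g))

/-- The partial Moyal product of two polynomials:
`f ∗ g = Σ_{r ≥ 0} (ℏ^r / r!) P^r(f,g)` (the sum is finite on polynomials:
all terms with `r > totalDegree f` vanish). -/
noncomputable def moyal0 (f g : NPoly) : Polynomial NPoly :=
  ∑ r ∈ Finset.range (f.totalDegree + 1),
    Polynomial.C ((r.factorial : ℝ)⁻¹ • poissonPow r f g) * Polynomial.X ^ r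

/-- The `ℝ[ℏ]`-bilinear extension of the partial Moyal product to
`N[ℏ] = (ℝ[x₁,x₂,x₃])[ℏ]`. -/
noncomputable def moyal (F G : Polynomial NPoly) : Polynomial NPoly :=
  F.sum fun i a => G.sum fun j b => Polynomial.X ^ (i + j) * moyal0 a b


/-- The deg-lex key of a monomial in three variables: monomials are compared
first by total degree and then lexicographically with respect to
`(x₁, x₂, x₃)` (for a fixed total degree the exponents of `x₁` and `x₂`
determine the monomial). -/
def degLexKey (d : Fin 3 →₀ ℕ) : Lex (ℕ × Lex (ℕ × ℕ)) :=
  toLex (d 0 + d 1 + d 2, toLex (d 0, d 1))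

/-- Recover a monomial from its deg-lex key. -/
noncomputable def ofDegLexKey (p : Lex (ℕ × Lex (ℕ × ℕ))) : Fin 3 →₀ ℕ :=
  Finsupp.equivFunOnFinite.symm
    ![(ofLex (ofLex p).2).1, (ofLex (ofLex p).2).2,
      (ofLex p).1 - (ofLex (ofLex p).2).1 - (ofLex (ofLex p).2).2]

/-- The maximal (deg-lex leading) monomial of a nonzero polynomial
`P ∈ ℝ[x₁,x₂,x₃]`, and `0` for the zero polynomial. -/
noncomputable def leadMonomial (P : MvPolynomial (Fin 3) ℝ) : Fin 3 →₀ ℕ :=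
  if h : P = 0 then 0
  else
    ofDegLexKey
      ((P.support.image degLexKey).max'
        (Finset.Nonempty.image
          (Finset.nonempty_iff_ne_empty.mpr fun he =>
            h (MvPolynomial.support_eq_empty.mp he)) _))

/-- The deg-lex leading coefficient of a polynomial in `ℝ[x₁,x₂,x₃]`:
the coefficient of its maximal monomial (and `0` for the zero
polynomial). -/
noncomputable def leadCoeff (P : MvPolynomial (Fin 3) ℝ) : ℝ :=
  P.coeff (leadMonomial P)

/-- The multiset of normalized (deg-lex leading coefficient `1`) irreducible
factors of a polynomial, obtained from a factorization into irreducibles by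
scaling each factor to be normalized.  For a normalized polynomial `P` this
realizes the unique factorization `P = P₁ ⋯ Pₙ` into normalized irreducible
factors underlying the map `α̃(P) = P₁ ⊗ ⋯ ⊗ Pₙ`. -/
noncomputable def normFactors (u : NPoly) : Multiset NPoly :=
  (UniqueFactorizationMonoid.factors u).map fun q => (leadCoeff q)⁻¹ • q

/-- The symmetrized Moyal evaluation of a list of polynomials:
`T(f₁ ⊗ ⋯ ⊗ fₙ) = (1/n!) Σ_{σ∈Sₙ} f_{σ(1)} ∗ ⋯ ∗ f_{σ(n)}`. -/
noncomputable def tsymList (l : List NPoly) : Polynomial NPoly :=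
  (l.length.factorial : ℝ)⁻¹ •
    ∑ σ : Equiv.Perm (Fin l.length),
      (List.ofFn fun i => Polynomial.C (l.get (σ i))).foldl moyal 1

/-- The symmetrized Moyal evaluation map `T` on a multiset of (tensor)
factors; it is well defined since `tsymList` is invariant under
permutations of the list. -/
noncomputable def tsym (s : Multiset NPoly) : Polynomial NPoly :=
  tsymList s.toList

/-- The Zariski product `×_α` on normalized polynomials:
`P ×_α Q = T(α̃(P) ⊗ α̃(Q))`, the symmetrized Moyal evaluation of the
concatenation of the normalized irreducible factors of `P` and of `Q`. -/
noncomputable def zariskiMul (u v : NPoly) : Polynomial NPoly :=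
  tsym (normFactors u + normFactors v)

/-- `N₁^ℏ`: the elements of `N[ℏ]` whose coefficient of the lowest power of
`ℏ` is a normalized polynomial (including `0`, since `0 ∈ N₁`). -/
def Nhbar : Set (Polynomial NPoly) :=
  {F | F.trailingCoeff = 0 ∨ leadCoeff F.trailingCoeff = 1}

/-- The product `×_α` on `N₁^ℏ`:
`P ×_α Q = T(α(P) ⊗ α(Q))` where `α = α̃ ∘ π` only takes into account the
classical part (`π` being the coefficient of `ℏ⁰`, and `α̃` the
factorization of a normalized polynomial into its normalized irreducible
factors, `α̃(0) = 0`). -/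
noncomputable def xalpha (F G : Polynomial NPoly) : Polynomial NPoly :=
  if F.coeff 0 = 0 ∨ G.coeff 0 = 0 then 0
  else zariskiMul (F.coeff 0) (G.coeff 0)

theorem ofDegLexKey_degLexKey (d : Fin 3 →₀ ℕ) : ofDegLexKey (degLexKey d) = d := by
  ext i
  fin_cases i <;> simp [ofDegLexKey, degLexKey]
  omega

theorem degLexKey_lt_of_degLex_lt {a b : Fin 3 →₀ ℕ} (h : toDegLex a < toDegLex b) :
    degLexKey a < degLexKey b := by
  rw [Finsupp.DegLex.lt_iff] at h
  simp only [ofDegLex_toDegLex, Finsupp.degree_eq_sum, Fin.sum_univ_three] at h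
  rw [degLexKey, degLexKey, Prod.Lex.toLex_lt_toLex]
  refine h.imp id fun ⟨hdeg, hlex⟩ => ⟨hdeg, ?_⟩
  rw [Prod.Lex.toLex_lt_toLex]
  obtain ⟨i, hi, hlt⟩ := Finsupp.lex_def.mp hlex
  simp only [ofLex_toLex] at hi hlt
  fin_cases i
  · exact Or.inl hlt
  · exact Or.inr ⟨hi 0 (by decide), hlt⟩
  · have h0 := hi 0 (by decide)
    have h1 := hi 1 (by decide)
    simp at hlt
    omega

theorem leadMonomial_eq_degree (P : NPoly) :
    leadMonomial P = MonomialOrder.degLex.degree P := by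
  by_cases h : P = 0
  · simp [leadMonomial, h]
  rw [leadMonomial, dif_neg h]
  rw [← ofDegLexKey_degLexKey (MonomialOrder.degLex.degree P)]
  congr 1
  refine le_antisymm (Finset.max'_le _ _ _ ?_) (Finset.le_max' _ _ ?_)
  · simp only [Finset.mem_image]
    rintro _ ⟨d, hd, rfl⟩
    rcases eq_or_lt_of_le (MonomialOrder.degLex.le_degree hd) with he | hlt
    · rw [MonomialOrder.degLex.toSyn.injective he]
    · exact (degLexKey_lt_of_degLex_lt hlt).le
  · exact Finset.mem_image_of_mem _ (MonomialOrder.degLex.degree_mem_support h)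

theorem leadCoeff_eq_leadingCoeff (P : NPoly) :
    leadCoeff P = MonomialOrder.degLex.leadingCoeff P := by
  rw [leadCoeff, leadMonomial_eq_degree, MonomialOrder.leadingCoeff]

theorem leadCoeff_mul (P Q : NPoly) : leadCoeff (P * Q) = leadCoeff P * leadCoeff Q := by
  simp only [leadCoeff_eq_leadingCoeff, MonomialOrder.leadingCoeff_mul]

theorem leadCoeff_C (c : ℝ) : leadCoeff (MvPolynomial.C c) = c := by
  simp [leadCoeff_eq_leadingCoeff]

theorem leadCoeff_zero : leadCoeff 0 = 0 := by
  simp [leadCoeff_eq_leadingCoeff]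

theorem leadCoeff_inv_smul_eq_of_associated {P Q : NPoly} (h : Associated P Q) :
    (leadCoeff P)⁻¹ • P = (leadCoeff Q)⁻¹ • Q := by
  obtain ⟨u, rfl⟩ := h
  obtain ⟨c, hc, hu⟩ := MvPolynomial.isUnit_iff_eq_C_of_isReduced.mp u.isUnit
  have hc0 : c ≠ 0 := hc.ne_zero
  rw [hu, leadCoeff_mul, leadCoeff_C, MvPolynomial.smul_eq_C_mul, MvPolynomial.smul_eq_C_mul,
    mul_inv, MvPolynomial.C_mul]
  have : (MvPolynomial.C c⁻¹ : NPoly) * MvPolynomial.C c = 1 := by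
    rw [← MvPolynomial.C_mul, inv_mul_cancel₀ hc0, MvPolynomial.C_1]
  linear_combination (-(MvPolynomial.C (leadCoeff P)⁻¹ * P)) * this

theorem normFactors_mul {u v : NPoly} (hu : u ≠ 0) (hv : v ≠ 0) :
    normFactors (u * v) = normFactors u + normFactors v := by
  rw [normFactors, normFactors, normFactors, ← Multiset.map_add, ← Multiset.rel_eq,
    Multiset.rel_map]
  exact (UniqueFactorizationMonoid.factors_mul hu hv).mono
    fun _ _ _ _ h => leadCoeff_inv_smul_eq_of_associated h

theorem prod_map_leadCoeff_inv_smul (s : Multiset NPoly) :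
    (s.map fun q => (leadCoeff q)⁻¹ • q).prod = (leadCoeff s.prod)⁻¹ • s.prod := by
  induction s using Multiset.induction_on with
  | empty =>
    have : leadCoeff 1 = 1 := leadCoeff_C 1
    simp [this]
  | cons a s ih =>
    rw [Multiset.map_cons, Multiset.prod_cons, Multiset.prod_cons, ih, leadCoeff_mul, mul_inv,
      smul_mul_smul_comm]

theorem prod_normFactors {u : NPoly} (hu : leadCoeff u = 1) : (normFactors u).prod = u := by
  have h0 : u ≠ 0 := by
    rintro rfl
    simp [leadCoeff_zero] at hu
  rw [normFactors, prod_map_leadCoeff_inv_smul,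
    leadCoeff_inv_smul_eq_of_associated (UniqueFactorizationMonoid.factors_prod h0), hu,
    inv_one, one_smul]

theorem coeff_zero_moyal0 (f g : NPoly) : (moyal0 f g).coeff 0 = f * g := by
  simp [moyal0, Finset.sum_range_succ', Polynomial.coeff_X_pow, poissonPow]

theorem coeff_zero_moyal (F G : Polynomial NPoly) :
    (moyal F G).coeff 0 = F.coeff 0 * G.coeff 0 := by
  simp only [moyal, Polynomial.sum_def, Polynomial.finsetSum_coeff, Polynomial.coeff_X_pow_mul']
  rw [Finset.sum_eq_single 0, Finset.sum_eq_single 0]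
  · simp [coeff_zero_moyal0]
  · intro j _ hj
    simp [hj]
  · intro h
    simp [coeff_zero_moyal0, Polynomial.notMem_support_iff.mp h]
  · intro i _ hi
    exact Finset.sum_eq_zero fun j _ => by simp [hi]
  · intro h
    exact Finset.sum_eq_zero fun j _ => by
      simp [coeff_zero_moyal0, Polynomial.notMem_support_iff.mp h]

theorem coeff_zero_foldl_moyal (l : List (Polynomial NPoly)) (F : Polynomial NPoly) :
    (l.foldl moyal F).coeff 0 = F.coeff 0 * (l.map fun G => G.coeff 0).prod := by
  induction l generalizing F with
  | nil => simp
  | cons G l ih => rw [List.foldl_cons, ih, coeff_zero_moyal, List.map_cons, List.prod_cons,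
      mul_assoc]

theorem coeff_zero_tsymList (l : List NPoly) : (tsymList l).coeff 0 = l.prod := by
  have hprod (σ : Equiv.Perm (Fin l.length)) :
      ((List.ofFn fun i => Polynomial.C (l.get (σ i))).foldl moyal 1).coeff 0 = l.prod := by
    rw [coeff_zero_foldl_moyal, List.map_ofFn, List.prod_ofFn]
    simp only [Function.comp_def, Polynomial.coeff_C_zero, Polynomial.coeff_one_zero, one_mul]
    rw [Equiv.prod_comp σ fun i => l.get i, ← List.prod_ofFn, List.ofFn_get]
  have hfac : (l.length.factorial : ℝ) ≠ 0 := by positivity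
  rw [tsymList, Polynomial.coeff_smul, Polynomial.finsetSum_coeff, Finset.sum_congr rfl
    fun σ _ => hprod σ, Finset.sum_const, Finset.card_univ, Fintype.card_perm, Fintype.card_fin,
    ← Nat.cast_smul_eq_nsmul ℝ, smul_smul, inv_mul_cancel₀ hfac, one_smul]

theorem coeff_zero_zariskiMul {u v : NPoly} (hu : leadCoeff u = 1) (hv : leadCoeff v = 1) :
    (zariskiMul u v).coeff 0 = u * v := by
  rw [zariskiMul, tsym, coeff_zero_tsymList, Multiset.prod_toList, Multiset.prod_add,
    prod_normFactors hu, prod_normFactors hv]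

theorem leadCoeff_coeff_zero_of_mem_Nhbar {F : Polynomial NPoly} (hF : F ∈ Nhbar)
    (h0 : F.coeff 0 ≠ 0) : leadCoeff (F.coeff 0) = 1 := by
  have ht : F.natTrailingDegree = 0 :=
    Nat.le_zero.mp (Polynomial.natTrailingDegree_le_of_ne_zero h0)
  have hF' : F.coeff 0 = 0 ∨ leadCoeff (F.coeff 0) = 1 := by
    simpa only [Nhbar, Set.mem_ofPred_eq, Polynomial.trailingCoeff, ht] using hF
  exact hF'.resolve_left h0

theorem mem_Nhbar_of_leadCoeff_coeff_zero {F : Polynomial NPoly}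
    (h : leadCoeff (F.coeff 0) = 1) : F ∈ Nhbar := by
  have h0 : F.coeff 0 ≠ 0 := by
    intro h0
    simp [h0, leadCoeff_zero] at h
  have ht : F.natTrailingDegree = 0 :=
    Nat.le_zero.mp (Polynomial.natTrailingDegree_le_of_ne_zero h0)
  exact Or.inr (by rwa [Polynomial.trailingCoeff, ht])

theorem coeff_zero_xalpha {F G : Polynomial NPoly} (hF : F ∈ Nhbar) (hG : G ∈ Nhbar) :
    (xalpha F G).coeff 0 = F.coeff 0 * G.coeff 0 := by
  by_cases hF0 : F.coeff 0 = 0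
  · simp [xalpha, hF0]
  by_cases hG0 : G.coeff 0 = 0
  · simp [xalpha, hG0]
  rw [xalpha, if_neg (not_or.mpr ⟨hF0, hG0⟩)]
  exact coeff_zero_zariskiMul (leadCoeff_coeff_zero_of_mem_Nhbar hF hF0)
    (leadCoeff_coeff_zero_of_mem_Nhbar hG hG0)

theorem xalpha_mem_Nhbar {F G : Polynomial NPoly} (hF : F ∈ Nhbar) (hG : G ∈ Nhbar) :
    xalpha F G ∈ Nhbar := by
  by_cases h : F.coeff 0 = 0 ∨ G.coeff 0 = 0
  · rw [xalpha, if_pos h]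
    exact Or.inl Polynomial.trailingCoeff_zero
  · obtain ⟨hF0, hG0⟩ := not_or.mp h
    apply mem_Nhbar_of_leadCoeff_coeff_zero
    rw [coeff_zero_xalpha hF hG, leadCoeff_mul, leadCoeff_coeff_zero_of_mem_Nhbar hF hF0,
      leadCoeff_coeff_zero_of_mem_Nhbar hG hG0, one_mul]

theorem xalpha_comm (F G : Polynomial NPoly) : xalpha F G = xalpha G F := by
  simp only [xalpha, zariskiMul, or_comm, add_comm]

theorem xalpha_assoc {F G H : Polynomial NPoly} (hF : F ∈ Nhbar) (hG : G ∈ Nhbar)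
    (hH : H ∈ Nhbar) : xalpha (xalpha F G) H = xalpha F (xalpha G H) := by
  rw [xalpha, coeff_zero_xalpha hF hG, xalpha.eq_def F, coeff_zero_xalpha hG hH]
  simp only [mul_eq_zero, or_assoc]
  split_ifs with h
  · rfl
  · simp only [not_or] at h
    obtain ⟨hF0, hG0, hH0⟩ := h
    rw [zariskiMul, zariskiMul, normFactors_mul hF0 hG0, normFactors_mul hG0 hH0, add_assoc]

/-- (Theorem 4 of the paper.)  The map `×_α` maps
`N₁^ℏ × N₁^ℏ` into `N₁^ℏ`; it is commutative and associative on `N₁^ℏ`;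
its classical part is multiplicative, `π(P ×_α Q) = π(P)·π(Q)`; and in
particular for normalized polynomials `P, Q ∈ N₁` the coefficient of `ℏ⁰`
in `P ×_α Q` is the usual product `P·Q`, so `×_α` is a deformation of the
usual product on `N₁`. -/
theorem zariski_xalpha_abelian_assoc_deformation :
    (∀ F ∈ Nhbar, ∀ G ∈ Nhbar, xalpha F G ∈ Nhbar) ∧
    (∀ F ∈ Nhbar, ∀ G ∈ Nhbar, xalpha F G = xalpha G F) ∧
    (∀ F ∈ Nhbar, ∀ G ∈ Nhbar, ∀ H ∈ Nhbar,
        xalpha (xalpha F G) H = xalpha F (xalpha G H)) ∧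
    (∀ F ∈ Nhbar, ∀ G ∈ Nhbar,
        (xalpha F G).coeff 0 = F.coeff 0 * G.coeff 0) ∧
    (∀ P Q : NPoly, leadCoeff P = 1 → leadCoeff Q = 1 →
        (xalpha (Polynomial.C P) (Polynomial.C Q)).coeff 0 = P * Q) := by
  exact ⟨fun _ hF _ hG => xalpha_mem_Nhbar hF hG, fun F _ G _ => xalpha_comm F G,
    fun _ hF _ hG _ hH => xalpha_assoc hF hG hH, fun _ hF _ hG => coeff_zero_xalpha hF hG,
    fun P Q hP hQ => by
      rw [coeff_zero_xalpha (mem_Nhbar_of_leadCoeff_coeff_zero (by simpa using hP))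
        (mem_Nhbar_of_leadCoeff_coeff_zero (by simpa using hQ)), Polynomial.coeff_C_zero,
        Polynomial.coeff_C_zero]⟩
end

section
/- For every ε ∈ ℝ, setting A := x₁² + ε²x₂² ∈ ℝ[x₁,x₂,x₃], the symmetrized triple partial Moyal product satisfies (1/3)[ (A ∗ x₂) ∗ x₂ + (x₂ ∗ A) ∗ x₂ + (x₂ ∗ x₂) ∗ A ] = (x₁² + ε²x₂²)·x₂² + (2/3)ℏ² in N[ℏ]. -/
theorem pd_iterate_zero (i : Fin 3) (n : ℕ) : (pd i)^[n] 0 = 0 :=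
  Function.iterate_fixed (map_zero (MvPolynomial.pderiv i)) n

theorem pd_two_mul (i : Fin 3) (f : NPoly) : pd i (2 * f) = 2 * pd i f := by
  simp only [pd, two_mul, map_add]

theorem poissonPow_zero_left (r : ℕ) (g : NPoly) : poissonPow r 0 g = 0 := by
  simp [poissonPow, pd_iterate_zero]

theorem poissonPow_zero_right (r : ℕ) (f : NPoly) : poissonPow r f 0 = 0 := by
  simp [poissonPow, pd_iterate_zero]

theorem moyal0_zero_left (g : NPoly) : moyal0 0 g = 0 := by
  simp [moyal0, poissonPow_zero_left]

theorem moyal0_zero_right (f : NPoly) : moyal0 f 0 = 0 := by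
  simp [moyal0, poissonPow_zero_right]

theorem poissonPow_zero (f g : NPoly) : poissonPow 0 f g = f * g := by
  simp [poissonPow]

theorem poissonPow_one (f g : NPoly) :
    poissonPow 1 f g = pd 0 f * pd 1 g - pd 1 f * pd 0 g := by
  simp [poissonPow, Finset.sum_range_succ, sub_eq_add_neg]

theorem pd_one_iterate_X_one (n : ℕ) :
    (pd 1)^[n + 2] (MvPolynomial.X 1 : NPoly) = 0 := by
  simp [Function.iterate_add_apply, pd, pd_iterate_zero]

theorem pd_zero_iterate_pd_one_iterate_X_one (m n : ℕ) :
    (pd 0)^[m + 1] ((pd 1)^[n] (MvPolynomial.X 1 : NPoly)) = 0 := by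
  have h : pd 0 ((pd 1)^[n] (MvPolynomial.X 1 : NPoly)) = 0 := by
    match n with
    | 0 => simp [pd]
    | 1 => simp [pd]
    | n + 2 => rw [pd_one_iterate_X_one]; simp [pd]
  rw [Function.iterate_succ_apply, h, pd_iterate_zero]

theorem poissonPow_X_one_right (r : ℕ) (f : NPoly) :
    poissonPow (r + 2) f (MvPolynomial.X 1) = 0 := by
  refine Finset.sum_eq_zero fun k _ => ?_
  cases k with
  | zero => simp [pd_one_iterate_X_one, -Function.iterate_succ]
  | succ k => rw [pd_zero_iterate_pd_one_iterate_X_one, mul_zero, smul_zero]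

theorem moyal0_X_one_right (f : NPoly) :
    moyal0 f (MvPolynomial.X 1) =
      Polynomial.C (f * MvPolynomial.X 1) + Polynomial.C (pd 0 f) * Polynomial.X := by
  unfold moyal0
  rcases hd : f.totalDegree with _ | d
  · have h : pd 0 f = 0 := by
      rw [MvPolynomial.totalDegree_eq_zero_iff_eq_C.mp hd]
      simp [pd]
    simp [poissonPow_zero, h]
  · rw [Finset.sum_range_succ', Finset.sum_range_succ', Finset.sum_eq_zero]
    · simp [poissonPow_zero, poissonPow_one, pd, add_comm]
    · intro r _
      rw [poissonPow_X_one_right]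
      simp

theorem moyal0_X_one_left (g : NPoly) :
    moyal0 (MvPolynomial.X 1) g =
      Polynomial.C (MvPolynomial.X 1 * g) - Polynomial.C (pd 0 g) * Polynomial.X := by
  simp [moyal0, Finset.sum_range_succ, poissonPow_zero, poissonPow_one, pd]
  ring

theorem moyal0_X_one_sq_left (g : NPoly) :
    moyal0 (MvPolynomial.X 1 ^ 2) g =
      Polynomial.C (MvPolynomial.X 1 ^ 2 * g) -
        Polynomial.C (2 * MvPolynomial.X 1 * pd 0 g) * Polynomial.X +
        Polynomial.C (pd 0 (pd 0 g)) * Polynomial.X ^ 2 := by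
  have h : poissonPow 2 (MvPolynomial.X 1 ^ 2) g = (2 : ℝ) • pd 0 (pd 0 g) := by
    have h₁ : pd 1 (MvPolynomial.X 1 ^ 2) = 2 * MvPolynomial.X 1 := by
      simp [pd, Derivation.leibniz_pow]
    have h₂ : pd 1 (MvPolynomial.X 1) = 1 := by simp [pd]
    have h₃ : pd 0 (MvPolynomial.X 1) = 0 := by simp [pd]
    have h₄ : pd 0 (MvPolynomial.X 1 ^ 2) = 0 := by simp [pd, Derivation.leibniz_pow]
    have h₅ : pd 0 0 = 0 := pd_iterate_zero 0 1
    simp [poissonPow, Finset.sum_range_succ, pd_two_mul, h₁, h₂, h₃, h₄, h₅, two_smul, ← two_mul]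
  simp [moyal0, Finset.sum_range_succ, poissonPow_zero, poissonPow_one, h, smul_smul,
    pd, Derivation.leibniz_pow]
  ring

theorem moyal_C_right (F : Polynomial NPoly) (g : NPoly) :
    moyal F (Polynomial.C g) = F.sum fun i a => Polynomial.X ^ i * moyal0 a g := by
  simp [moyal, moyal0_zero_right, Polynomial.sum_C_index]

theorem moyal_C_C (f g : NPoly) :
    moyal (Polynomial.C f) (Polynomial.C g) = moyal0 f g := by
  simp [moyal_C_right, moyal0_zero_left, Polynomial.sum_C_index]

theorem moyal_linear_C (a b g : NPoly) :
    moyal (Polynomial.C a + Polynomial.C b * Polynomial.X) (Polynomial.C g) =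
      moyal0 a g + Polynomial.X * moyal0 b g := by
  rw [moyal_C_right, Polynomial.sum_over_range' _ (by simp [moyal0_zero_left]) 2]
  · simp [Finset.sum_range_succ]
  · rw [add_comm]
    exact Nat.lt_succ_of_le Polynomial.natDegree_linear_le

/-- For every `ε ∈ ℝ`, with `A = x₁² + ε²x₂²`, the
symmetrized triple partial Moyal product satisfies
`(1/3)[(A ∗ x₂) ∗ x₂ + (x₂ ∗ A) ∗ x₂ + (x₂ ∗ x₂) ∗ A]
  = (x₁² + ε²x₂²)·x₂² + (2/3)ℏ²` in `N[ℏ]`. -/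
theorem symmetrized_moyal_example (ε : ℝ) :
    ((3 : ℝ)⁻¹) •
        (moyal (moyal (Polynomial.C (MvPolynomial.X 0 ^ 2 +
              MvPolynomial.C (ε ^ 2) * MvPolynomial.X 1 ^ 2 : NPoly))
              (Polynomial.C (MvPolynomial.X 1 : NPoly)))
            (Polynomial.C (MvPolynomial.X 1 : NPoly)) +
          moyal (moyal (Polynomial.C (MvPolynomial.X 1 : NPoly))
              (Polynomial.C (MvPolynomial.X 0 ^ 2 +
                MvPolynomial.C (ε ^ 2) * MvPolynomial.X 1 ^ 2 : NPoly)))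
            (Polynomial.C (MvPolynomial.X 1 : NPoly)) +
          moyal (moyal (Polynomial.C (MvPolynomial.X 1 : NPoly))
              (Polynomial.C (MvPolynomial.X 1 : NPoly)))
            (Polynomial.C (MvPolynomial.X 0 ^ 2 +
              MvPolynomial.C (ε ^ 2) * MvPolynomial.X 1 ^ 2 : NPoly))) =
      Polynomial.C ((MvPolynomial.X 0 ^ 2 +
          MvPolynomial.C (ε ^ 2) * MvPolynomial.X 1 ^ 2 : NPoly) *
          MvPolynomial.X 1 ^ 2) +
        ((2 : ℝ) / 3) • Polynomial.X ^ 2 := by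
  set A : NPoly := MvPolynomial.X 0 ^ 2 + MvPolynomial.C (ε ^ 2) * MvPolynomial.X 1 ^ 2 with hA
  have hA₁ : pd 0 A = 2 * MvPolynomial.X 0 := by
    simp [hA, pd, Derivation.leibniz_pow]
  have hA₂ : pd 0 (2 * MvPolynomial.X 0) = 2 := by
    rw [pd_two_mul]
    simp [pd]
  have hAX : pd 0 (A * MvPolynomial.X 1) = 2 * MvPolynomial.X 0 * MvPolynomial.X 1 := by
    rw [← hA₁]
    simp [pd, mul_comm]
  have hXA : pd 0 (MvPolynomial.X 1 * A) = 2 * MvPolynomial.X 0 * MvPolynomial.X 1 := by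
    rw [mul_comm, hAX]
  have hneg : pd 0 (-(2 * MvPolynomial.X 0)) = -2 := by
    rw [pd, map_neg]
    exact congrArg Neg.neg hA₂
  have hX : pd 0 (MvPolynomial.X 1) = 0 := by simp [pd]
  have first : moyal (moyal (Polynomial.C A) (Polynomial.C (MvPolynomial.X 1)))
      (Polynomial.C (MvPolynomial.X 1)) = Polynomial.C (A * MvPolynomial.X 1 ^ 2) +
        Polynomial.C (4 * MvPolynomial.X 0 * MvPolynomial.X 1) * Polynomial.X +
        2 * Polynomial.X ^ 2 := by
    rw [moyal_C_C, moyal0_X_one_right, moyal_linear_C, moyal0_X_one_right, moyal0_X_one_right,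
      hA₁, hAX, hA₂]
    simp only [map_mul, map_pow, map_ofNat]
    ring
  have second : moyal (moyal (Polynomial.C (MvPolynomial.X 1)) (Polynomial.C A))
      (Polynomial.C (MvPolynomial.X 1)) = Polynomial.C (A * MvPolynomial.X 1 ^ 2) -
        2 * Polynomial.X ^ 2 := by
    have h : Polynomial.C (MvPolynomial.X 1 * A) - Polynomial.C (pd 0 A) * Polynomial.X =
        Polynomial.C (MvPolynomial.X 1 * A) + Polynomial.C (-pd 0 A) * Polynomial.X := by
      rw [map_neg]
      ring
    rw [moyal_C_C, moyal0_X_one_left, h, moyal_linear_C, moyal0_X_one_right, moyal0_X_one_right, hA₁, hXA, hneg]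
    simp only [map_mul, map_pow, map_neg, map_ofNat]
    ring
  have third : moyal (moyal (Polynomial.C (MvPolynomial.X 1)) (Polynomial.C (MvPolynomial.X 1)))
      (Polynomial.C A) = Polynomial.C (A * MvPolynomial.X 1 ^ 2) -
        Polynomial.C (4 * MvPolynomial.X 0 * MvPolynomial.X 1) * Polynomial.X +
        2 * Polynomial.X ^ 2 := by
    rw [moyal_C_C, moyal0_X_one_left, hX, map_zero, zero_mul, sub_zero, ← sq, moyal_C_C,
      moyal0_X_one_sq_left, hA₁, hA₂]
    simp only [map_mul, map_pow, map_ofNat]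
    ring
  have h : (2 : Polynomial NPoly) * Polynomial.X ^ 2 = (2 : ℝ) • Polynomial.X ^ 2 := by
    rw [two_mul, two_smul]
  rw [first, second, third, h]
  module
end

section
/- In ℝ[x,y]: (i) the polynomial u = x³ + x²y + 4xy² + 5y³ + 5xy + (17/2)y² + 4y is irreducible; (ii) its partial derivative ∂u/∂x = 3x² + 2xy + 4y² + 5y is irreducible; (iii) its partial derivative ∂u/∂y = x² + 8xy + 15y² + 5x + 17y + 4 is reducible, namely ∂u/∂y = (x + 3y + 1)(x + 5y + 4). Hence the two partial derivatives of the irreducible polynomial u factor into different numbers of irreducible factors. -/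
open MvPolynomial

/-- The polynomial `u = x³ + x²y + 4xy² + 5y³ + 5xy + (17/2)y² + 4y`
in `ℝ[x,y]` (with `x = X 0`, `y = X 1`). -/
noncomputable def uExample : MvPolynomial (Fin 2) ℝ :=
  X 0 ^ 3 + X 0 ^ 2 * X 1 + C 4 * X 0 * X 1 ^ 2 + C 5 * X 1 ^ 3 +
    C 5 * X 0 * X 1 + C (17 / 2) * X 1 ^ 2 + C 4 * X 1

open Polynomial in
/-- Eisenstein's criterion at a prime element, for polynomials whose leading coefficient is a
unit. -/
theorem irreducible_of_eisenstein_prime {R : Type*} [CommRing R] [IsDomain R] {π : R}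
    (hπ : Prime π) {f : R[X]} (hlead : IsUnit f.leadingCoeff) (hdeg : 0 < f.natDegree)
    (hdvd : ∀ n < f.natDegree, π ∣ f.coeff n) (h0 : ¬ π ^ 2 ∣ f.coeff 0) :
    Irreducible f := by
  have hP : (Ideal.span {π}).IsPrime := (Ideal.span_singleton_prime hπ.ne_zero).2 hπ
  refine irreducible_of_eisenstein_criterion hP ?_ ?_ (natDegree_pos_iff_degree_pos.1 hdeg) ?_ ?_
  · exact fun h => hP.ne_top (Ideal.eq_top_of_isUnit_mem _ h hlead)
  · exact fun n hn => Ideal.mem_span_singleton.2 (hdvd n (coe_lt_degree.1 hn))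
  · rwa [Ideal.span_singleton_pow, Ideal.mem_span_singleton]
  · exact fun r hr => isUnit_of_dvd_unit ((C_dvd_iff_dvd_coeff r f).1 hr _) hlead

theorem not_X_sq_dvd_X_mul {σ K : Type*} [Field K] (i : σ) {q : MvPolynomial σ K}
    (hq : constantCoeff q ≠ 0) : ¬ (X i : MvPolynomial σ K) ^ 2 ∣ X i * q := by
  rw [sq, mul_dvd_mul_iff_left (X_ne_zero i)]
  rintro ⟨r, rfl⟩
  simp at hq

theorem finSuccEquiv_C {R : Type*} [CommSemiring R] (n : ℕ) (a : R) :
    finSuccEquiv R n (C a) = Polynomial.C (C a) := by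
  simp [finSuccEquiv_apply]

theorem finSuccEquiv_one_X_one {R : Type*} [CommSemiring R] :
    finSuccEquiv R 1 (X 1) = Polynomial.C (X 0) :=
  finSuccEquiv_X_succ (j := 0)

theorem irreducible_uExample : Irreducible uExample := by
  rw [← MulEquiv.irreducible_iff (finSuccEquiv ℝ 1)]
  have hu : finSuccEquiv ℝ 1 uExample =
      Polynomial.C 1 * Polynomial.X ^ 3 + Polynomial.C (X 0) * Polynomial.X ^ 2 +
        Polynomial.C (X 0 * (C 4 * X 0 + C 5)) * Polynomial.X +
        Polynomial.C (X 0 * (C 5 * X 0 ^ 2 + C (17 / 2) * X 0 + C 4)) := by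
    simp only [uExample, map_add, map_mul, map_pow, finSuccEquiv_X_zero,
      finSuccEquiv_one_X_one, finSuccEquiv_C, map_one]
    ring
  rw [hu]
  have hne : (1 : MvPolynomial (Fin 1) ℝ) ≠ 0 := one_ne_zero
  refine irreducible_of_eisenstein_prime (π := X 0) (X_prime (i := 0)) ?_ ?_ ?_ ?_
  · rw [Polynomial.leadingCoeff_cubic hne]
    exact isUnit_one
  · rw [Polynomial.natDegree_cubic hne]
    norm_num
  · intro n hn
    rw [Polynomial.natDegree_cubic hne] at hn
    interval_cases n <;> simp [Polynomial.coeff_X, Polynomial.coeff_C, -map_mul, -map_add]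
  · have := not_X_sq_dvd_X_mul (0 : Fin 1)
      (q := (C 5 * X 0 ^ 2 + C (17 / 2) * X 0 + C 4 : MvPolynomial (Fin 1) ℝ)) (by simp)
    simpa [-map_mul, -map_add] using this

theorem irreducible_pderiv_zero_uExample :
    Irreducible (C 3 * X 0 ^ 2 + C 2 * X 0 * X 1 + C 4 * X 1 ^ 2 + C 5 * X 1 :
      MvPolynomial (Fin 2) ℝ) := by
  rw [← MulEquiv.irreducible_iff (finSuccEquiv ℝ 1)]
  have hu : finSuccEquiv ℝ 1
      (C 3 * X 0 ^ 2 + C 2 * X 0 * X 1 + C 4 * X 1 ^ 2 + C 5 * X 1) =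
      Polynomial.C (C 3) * Polynomial.X ^ 2 + Polynomial.C (X 0 * C 2) * Polynomial.X +
        Polynomial.C (X 0 * (C 4 * X 0 + C 5)) := by
    simp only [map_add, map_mul, map_pow, finSuccEquiv_X_zero,
      finSuccEquiv_one_X_one, finSuccEquiv_C]
    ring
  rw [hu]
  have hne : (C 3 : MvPolynomial (Fin 1) ℝ) ≠ 0 := C_ne_zero.2 three_ne_zero
  refine irreducible_of_eisenstein_prime (π := X 0) (X_prime (i := 0)) ?_ ?_ ?_ ?_
  · rw [Polynomial.leadingCoeff_quadratic hne]
    exact (isUnit_iff_ne_zero.2 three_ne_zero).map C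
  · rw [Polynomial.natDegree_quadratic hne]
    norm_num
  · intro n hn
    rw [Polynomial.natDegree_quadratic hne] at hn
    interval_cases n <;> simp [Polynomial.coeff_X, Polynomial.coeff_C, -map_mul, -map_add]
  · have := not_X_sq_dvd_X_mul (0 : Fin 1)
      (q := (C 4 * X 0 + C 5 : MvPolynomial (Fin 1) ℝ)) (by simp)
    simpa [-map_mul, -map_add] using this

/-- A polynomial with vanishing value somewhere is not a unit. -/
theorem not_isUnit_of_eval_eq_zero {σ K : Type*} [Field K] {p : MvPolynomial σ K} (v : σ → K)
    (h : eval v p = 0) : ¬ IsUnit p :=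
  fun hp => (hp.map (eval v)).ne_zero h

theorem pderiv_zero_uExample :
    pderiv 0 uExample =
      C 3 * X 0 ^ 2 + C 2 * X 0 * X 1 + C 4 * X 1 ^ 2 + C 5 * X 1 := by
  simp [uExample, pderiv_X]
  simp only [map_ofNat C]
  ring

theorem pderiv_one_uExample :
    pderiv 1 uExample =
      X 0 ^ 2 + C 8 * X 0 * X 1 + C 15 * X 1 ^ 2 + C 5 * X 0 + C 17 * X 1 + C 4 := by
  have h : (C (17 / 2) * 2 : MvPolynomial (Fin 2) ℝ) = 17 := by
    rw [← map_ofNat C 2, ← map_ofNat C 17, ← C_mul]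
    norm_num
  simp [uExample, pderiv_X]
  simp only [map_ofNat C]
  linear_combination X 1 * h

theorem pderiv_one_uExample_eq_mul :
    pderiv 1 uExample = (X 0 + C 3 * X 1 + C 1) * (X 0 + C 5 * X 1 + C 4) := by
  rw [pderiv_one_uExample]
  simp only [map_ofNat, map_one]
  ring

/-- **Statement 19.** In `ℝ[x,y]`: (i) the polynomial
`u = x³ + x²y + 4xy² + 5y³ + 5xy + (17/2)y² + 4y` is irreducible;
(ii) its partial derivative `∂u/∂x = 3x² + 2xy + 4y² + 5y` is irreducible;
(iii) its partial derivative `∂u/∂y = x² + 8xy + 15y² + 5x + 17y + 4` is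
reducible, namely `∂u/∂y = (x + 3y + 1)(x + 5y + 4)`.  Hence the two
partial derivatives of the irreducible `u` factor into different numbers
of irreducible factors. -/
theorem derivatives_of_irreducible_factor_differently :
    Irreducible uExample ∧
    pderiv 0 uExample =
      C 3 * X 0 ^ 2 + C 2 * X 0 * X 1 + C 4 * X 1 ^ 2 + C 5 * X 1 ∧
    Irreducible
      (C 3 * X 0 ^ 2 + C 2 * X 0 * X 1 + C 4 * X 1 ^ 2 + C 5 * X 1 :
        MvPolynomial (Fin 2) ℝ) ∧
    pderiv 1 uExample =
      X 0 ^ 2 + C 8 * X 0 * X 1 + C 15 * X 1 ^ 2 + C 5 * X 0 + C 17 * X 1 + C 4 ∧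
    pderiv 1 uExample = (X 0 + C 3 * X 1 + C 1) * (X 0 + C 5 * X 1 + C 4) ∧
    ¬ Irreducible (pderiv 1 uExample) := by
  refine ⟨irreducible_uExample, pderiv_zero_uExample, irreducible_pderiv_zero_uExample,
    pderiv_one_uExample, pderiv_one_uExample_eq_mul, fun h => ?_⟩
  rcases h.isUnit_or_isUnit pderiv_one_uExample_eq_mul with h | h
  · exact not_isUnit_of_eval_eq_zero ![-1, 0] (by simp) h
  · exact not_isUnit_of_eval_eq_zero ![-4, 0] (by simp) h
end
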